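/- For every n ≥ 2, c_{n+2} = 2 w_{n+1} (2^n w_n + y_n) r_n, and 2 r_n divides g_{n+2}. -/

import Mathlib

namespace Paper

/-- `s i = 2^{ν₂(i+1)}`, the largest power of 2 dividing `i+1`. -/
def s (i : ℕ) : ℕ := 2 ^ padicValNat 2 (i + 1)

/-- Continuant numerators, shifted by 2: `p 0 = p_{-2} = 0`, `p 1 = p_{-1} = 1`,
and `p (n+2) = p_n = s_n p_{n-1} + p_{n-2}`. -/
def p : ℕ → ℤ
  | 0 => 0
  | 1 => 1
  | n + 2 => (s n : ℤ) * p (n + 1) + p n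

/-- Continuant denominators, shifted by 2: `q 0 = q_{-2} = 1`, `q 1 = q_{-1} = 0`,
and `q (n+2) = q_n = s_n q_{n-1} + q_{n-2}`. -/
def q : ℕ → ℤ
  | 0 => 1
  | 1 => 0
  | n + 2 => (s n : ℤ) * q (n + 1) + q n

/-- Hurwitz–Kolden–Frame matrix of a finite sequence. -/
def M (l : List ℤ) : Matrix (Fin 2) (Fin 2) ℤ :=
  (l.map fun a => !![a, 1; 1, 0]).prod

/-- `u n = (s_1, s_2, ..., s_{2^n - 3})`. -/
def u (n : ℕ) : List ℤ := (List.range (2 ^ n - 3)).map fun i => (s (i + 1) : ℤ)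

/-- `v n = (s_1, s_2, ..., s_{2^n - 2})`. -/
def v (n : ℕ) : List ℤ := (List.range (2 ^ n - 2)).map fun i => (s (i + 1) : ℤ)

def c (n : ℕ) : ℤ := M (u n) 0 0
def e (n : ℕ) : ℤ := M (u n) 0 1
def d (n : ℕ) : ℤ := M (u n) 1 0
def f (n : ℕ) : ℤ := M (u n) 1 1
def w (n : ℕ) : ℤ := M (v n) 0 0
def y (n : ℕ) : ℤ := M (v n) 0 1
def x (n : ℕ) : ℤ := M (v n) 1 0
def z (n : ℕ) : ℤ := M (v n) 1 1
def g (n : ℕ) : ℤ := c n + 2 * e n + f n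
def r (n : ℕ) : ℤ := 2 ^ n * (w n + x n) + w n + y n + z n

end Paper

open Paper Filter Real

namespace Paper

lemma s_two_pow_add {n j : ℕ} (hj : j + 1 < 2 ^ n) : s (2 ^ n + j) = s j := by
  have hdvd (k : ℕ) (hk : k ≤ n) : 2 ^ k ∣ 2 ^ n + j + 1 ↔ 2 ^ k ∣ j + 1 := by
    rw [add_assoc, Nat.dvd_add_right (pow_dvd_pow 2 hk)]
  have hlt : padicValNat 2 (j + 1) < n := by
    rw [← not_le, ← padicValNat_dvd_iff_le (by lia)]
    exact fun h => absurd (Nat.le_of_dvd (by lia) h) (by lia)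
  unfold s
  congr 1
  apply le_antisymm
  · rw [← not_lt, Nat.lt_iff_add_one_le, ← padicValNat_dvd_iff_le (by lia), hdvd _ (by lia)]
    exact pow_succ_padicValNat_not_dvd (by lia)
  · rw [← padicValNat_dvd_iff_le (by lia), hdvd _ hlt.le]
    exact pow_padicValNat_dvd

lemma s_of_even {j : ℕ} (hj : Even j) : s j = 1 := by
  rw [s, padicValNat.eq_zero_of_not_dvd (by grind), pow_zero]

lemma s_two_pow_sub_one (n : ℕ) : s (2 ^ n - 1) = 2 ^ n := by
  rw [s, Nat.sub_add_cancel Nat.one_le_two_pow, padicValNat.prime_pow]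

lemma even_two_pow {n : ℕ} (hn : 2 ≤ n) : Even (2 ^ n) :=
  (Nat.even_pow.2 ⟨even_two, by lia⟩)

lemma four_le_two_pow {n : ℕ} (hn : 2 ≤ n) : 4 ≤ 2 ^ n :=
  Nat.pow_le_pow_right (n := 2) two_pos hn

lemma v_eq_u_append {n : ℕ} (hn : 2 ≤ n) : v n = u n ++ [1] := by
  have h4 := four_le_two_pow hn
  have he := even_two_pow hn
  have hs : s (2 ^ n - 3 + 1) = 1 := s_of_even (by grind)
  rw [v, u, show 2 ^ n - 2 = 2 ^ n - 3 + 1 by lia, List.range_succ, List.map_append]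
  simp [hs]

lemma u_succ {n : ℕ} (hn : 2 ≤ n) : u (n + 1) = u n ++ [1, 2 ^ n, 1] ++ u n := by
  have h4 := four_le_two_pow hn
  have he := even_two_pow hn
  have h₁ : s (2 ^ n - 3 + 1) = 1 := s_of_even (by grind)
  have h₂ : s (2 ^ n - 3 + 1 + 1) = 2 ^ n := by
    rw [show 2 ^ n - 3 + 1 + 1 = 2 ^ n - 1 by lia, s_two_pow_sub_one]
  have h₃ : s (2 ^ n - 3 + 2 + 1) = 1 := s_of_even (by grind)
  rw [u, u, show 2 ^ (n + 1) - 3 = (2 ^ n - 3) + 3 + (2 ^ n - 3) by rw [pow_succ]; lia,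
    List.range_add, List.range_add, List.map_append, List.map_append]
  congr 1
  · simp [List.range_succ, h₁, h₂, h₃]
  · simp only [List.map_map]
    refine List.map_congr_left fun i hi => ?_
    have hi := List.mem_range.1 hi
    have : 2 ^ n - 3 + 3 + i + 1 = 2 ^ n + (i + 1) := by lia
    simp only [Function.comp_apply, this]
    rw [s_two_pow_add (by lia)]

lemma M_append (l₁ l₂ : List ℤ) : M (l₁ ++ l₂) = M l₁ * M l₂ := by
  simp [M]

lemma M_u {n : ℕ} : M (u n) = !![c n, e n; d n, f n] :=
  Matrix.eta_fin_two _

lemma M_v_eq {n : ℕ} (hn : 2 ≤ n) :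
    M (v n) = !![c n + e n, c n; d n + f n, d n] := by
  rw [v_eq_u_append hn, M_append, M_u]
  simp [M]

lemma M_u_succ {n : ℕ} (hn : 2 ≤ n) :
    M (u (n + 1)) = !![c n, e n; d n, f n] *
      !![2 ^ n + 2, 2 ^ n + 1; 2 ^ n + 1, 2 ^ n] * !![c n, e n; d n, f n] := by
  have h : M [1, 2 ^ n, 1] = !![2 ^ n + 2, 2 ^ n + 1; 2 ^ n + 1, 2 ^ n] := by
    simp [M]
    ring
  rw [u_succ hn, M_append, M_append, M_u, h]

lemma d_eq_e {n : ℕ} (hn : 2 ≤ n) : d n = e n := by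
  induction n, hn using Nat.le_induction with
  | base => simp [d, e, u, M]
  | succ n hn ih =>
    rw [d, e, M_u_succ hn, ih]
    simp
    ring

lemma c_succ {n : ℕ} (hn : 2 ≤ n) :
    c (n + 1) = (2 ^ n + 2) * c n ^ 2 + 2 * (2 ^ n + 1) * c n * e n + 2 ^ n * e n ^ 2 := by
  rw [c, M_u_succ hn, d_eq_e hn]
  simp
  ring

lemma e_succ {n : ℕ} (hn : 2 ≤ n) :
    e (n + 1) = (2 ^ n + 2) * c n * e n + (2 ^ n + 1) * (c n * f n + e n ^ 2)
      + 2 ^ n * e n * f n := by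
  rw [e, M_u_succ hn, d_eq_e hn]
  simp
  ring

lemma f_succ {n : ℕ} (hn : 2 ≤ n) :
    f (n + 1) = (2 ^ n + 2) * e n ^ 2 + 2 * (2 ^ n + 1) * e n * f n + 2 ^ n * f n ^ 2 := by
  rw [f, M_u_succ hn, d_eq_e hn]
  simp
  ring

lemma w_eq {n : ℕ} (hn : 2 ≤ n) : w n = c n + e n := by simp [w, M_v_eq hn]

lemma y_eq {n : ℕ} (hn : 2 ≤ n) : y n = c n := by simp [y, M_v_eq hn]

lemma r_eq {n : ℕ} (hn : 2 ≤ n) :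
    r n = 2 ^ n * (c n + 2 * e n + f n) + 2 * (c n + e n) := by
  simp only [r, w, x, y, z, M_v_eq hn, d_eq_e hn]
  simp
  ring

lemma g_succ {n : ℕ} (hn : 2 ≤ n) : g (n + 1) = g n * r n := by
  rw [g, g, c_succ hn, e_succ hn, f_succ hn, r_eq hn]
  ring

lemma even_r {n : ℕ} (hn : 2 ≤ n) : 2 ∣ r n := by
  rw [r_eq hn]
  exact dvd_add (Dvd.dvd.mul_right (dvd_pow_self 2 (by lia)) _) (dvd_mul_right 2 _)

end Paper

/-- For n ≥ 2, `c_{n+2} = 2 w_{n+1} (2^n w_n + y_n) r_n` and `2 r_n ∣ g_{n+2}`. -/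
theorem c_g_two_succ (n : ℕ) (hn : 2 ≤ n) :
    c (n + 2) = 2 * w (n + 1) * (2 ^ n * w n + y n) * r n ∧
    (2 * r n) ∣ g (n + 2) := by
  have hn' : 2 ≤ n + 1 := by lia
  constructor
  · rw [c_succ hn', w_eq hn', w_eq hn, y_eq hn, r_eq hn, c_succ hn, e_succ hn]
    ring
  · rw [g_succ hn', g_succ hn, mul_comm 2 (r n)]
    exact mul_dvd_mul (dvd_mul_left _ _) (even_r hn')
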